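/- For every n ≥ 2, the finite sequence u(n) = (s_1, s_2, ..., s_{2^n−3}) is a palindrome, i.e., it equals its reversal. -/

import Mathlib

namespace Paper

/-- `s i = 2^{ν₂(i+1)}`, the largest power of 2 dividing `i+1`. -/
def s (i : ℕ) : ℕ := 2 ^ padicValNat 2 (i + 1)

/-- Continuant numerators, shifted by 2: `p 0 = p_{-2} = 0`, `p 1 = p_{-1} = 1`,
and `p (n+2) = p_n = s_n p_{n-1} + p_{n-2}`. -/
def p : ℕ → ℤ
  | 0 => 0
  | 1 => 1
  | n + 2 => (s n : ℤ) * p (n + 1) + p n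

/-- Continuant denominators, shifted by 2: `q 0 = q_{-2} = 1`, `q 1 = q_{-1} = 0`,
and `q (n+2) = q_n = s_n q_{n-1} + q_{n-2}`. -/
def q : ℕ → ℤ
  | 0 => 1
  | 1 => 0
  | n + 2 => (s n : ℤ) * q (n + 1) + q n

/-- Hurwitz–Kolden–Frame matrix of a finite sequence. -/
def M (l : List ℤ) : Matrix (Fin 2) (Fin 2) ℤ :=
  (l.map fun a => !![a, 1; 1, 0]).prod

/-- `u n = (s_1, s_2, ..., s_{2^n - 3})`. -/
def u (n : ℕ) : List ℤ := (List.range (2 ^ n - 3)).map fun i => (s (i + 1) : ℤ)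

/-- `v n = (s_1, s_2, ..., s_{2^n - 2})`. -/
def v (n : ℕ) : List ℤ := (List.range (2 ^ n - 2)).map fun i => (s (i + 1) : ℤ)

def c (n : ℕ) : ℤ := M (u n) 0 0
def e (n : ℕ) : ℤ := M (u n) 0 1
def d (n : ℕ) : ℤ := M (u n) 1 0
def f (n : ℕ) : ℤ := M (u n) 1 1
def w (n : ℕ) : ℤ := M (v n) 0 0
def y (n : ℕ) : ℤ := M (v n) 0 1
def x (n : ℕ) : ℤ := M (v n) 1 0
def z (n : ℕ) : ℤ := M (v n) 1 1
def g (n : ℕ) : ℤ := c n + 2 * e n + f n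
def r (n : ℕ) : ℤ := 2 ^ n * (w n + x n) + w n + y n + z n

end Paper

open Paper Filter Real

theorem padicValNat_le_of_add_eq_prime_pow {l a b n : ℕ} [hl : Fact l.Prime] (ha : a ≠ 0)
    (hb : b ≠ 0) (h : a + b = l ^ n) : padicValNat l a ≤ padicValNat l b := by
  have hdvd : l ^ padicValNat l a ∣ a := pow_padicValNat_dvd
  have hle : padicValNat l a ≤ n := by
    refine (Nat.pow_le_pow_iff_right hl.out.one_lt).1 ?_
    have := Nat.le_of_dvd (Nat.pos_of_ne_zero ha) hdvd
    omega
  refine (padicValNat_dvd_iff_le hb).1 ((Nat.dvd_add_right hdvd).1 ?_)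
  exact h ▸ pow_dvd_pow l hle

theorem padicValNat_eq_of_add_eq_prime_pow {l a b n : ℕ} [Fact l.Prime] (ha : a ≠ 0)
    (hb : b ≠ 0) (h : a + b = l ^ n) : padicValNat l a = padicValNat l b :=
  (padicValNat_le_of_add_eq_prime_pow ha hb h).antisymm
    (padicValNat_le_of_add_eq_prime_pow hb ha (add_comm a b ▸ h))

/-- For n ≥ 2, `u(n)` is a palindrome. -/
theorem u_palindrome (n : ℕ) (hn : 2 ≤ n) :
    (u n).reverse = u n := by
  apply List.ext_getElem
  · simp
  · intro i hi _
    simp only [u, List.length_reverse, List.length_map, List.length_range] at hi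
    simp only [u, List.getElem_reverse, List.getElem_map, List.getElem_range, List.length_map,
      List.length_range, s]
    rw [padicValNat_eq_of_add_eq_prime_pow (l := 2) (b := i + 1 + 1) (n := n)
      (by omega) (by omega) (by omega)]
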